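/- Let V be an n-dimensional complex vector space and P ∈ Γ(V), with λ^m denoting operators obtained from canonical basis pairs. (a) If m = dim Indef P, then λ^m(P) has rank 1, and for every Q ∈ Γ(V) with Indef Q = Indef P and Dom Q = Dom P (in particular for Q = Dom P ⊕ Indef P) the operator λ^m(Q) is a nonzero scalar multiple of λ^m(P). (b) If m = dim Im P, then λ^m(P) has rank 1, and for every R ∈ Γ(V) with Im R = Im P and Ker R = Ker P (in particular for R = Ker P ⊕ Im P) the operator λ^m(R) is a nonzero scalar multiple of λ^m(P). -/

import Mathlib

open Module

noncomputable section

variable {V W Y Z : Type*}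
  [AddCommGroup V] [Module ℂ V] [AddCommGroup W] [Module ℂ W]
  [AddCommGroup Y] [Module ℂ Y] [AddCommGroup Z] [Module ℂ Z]

/-- The kernel of a linear relation `P : V ⇉ W`. -/
def relKer (P : Submodule ℂ (V × W)) : Submodule ℂ V :=
  P.comap (LinearMap.inl ℂ V W)

/-- The indefiniteness of a linear relation `P : V ⇉ W`. -/
def relIndef (P : Submodule ℂ (V × W)) : Submodule ℂ W :=
  P.comap (LinearMap.inr ℂ V W)

/-- The domain of a linear relation `P : V ⇉ W`. -/
def relDom (P : Submodule ℂ (V × W)) : Submodule ℂ V :=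
  P.map (LinearMap.fst ℂ V W)

/-- The image of a linear relation `P : V ⇉ W`. -/
def relIm (P : Submodule ℂ (V × W)) : Submodule ℂ W :=
  P.map (LinearMap.snd ℂ V W)

/-- The product `QP` of two linear relations. -/
def relComp (Q : Submodule ℂ (W × Y)) (P : Submodule ℂ (V × W)) : Submodule ℂ (V × Y) where
  carrier := {p | ∃ w : W, (p.1, w) ∈ P ∧ (w, p.2) ∈ Q}
  add_mem' := by
    rintro ⟨a, b⟩ ⟨c, d⟩ ⟨w₁, h₁, h₂⟩ ⟨w₂, h₃, h₄⟩
    exact ⟨w₁ + w₂, P.add_mem h₁ h₃, Q.add_mem h₂ h₄⟩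
  zero_mem' := ⟨0, P.zero_mem, Q.zero_mem⟩
  smul_mem' := by
    rintro c ⟨a, b⟩ ⟨w, h₁, h₂⟩
    exact ⟨c • w, P.smul_mem c h₁, Q.smul_mem c h₂⟩

/-- The pair `(Q, P)` of linear relations is transversal. -/
def Transversal (Q : Submodule ℂ (W × Y)) (P : Submodule ℂ (V × W)) : Prop :=
  relIm P ⊔ relDom Q = ⊤ ∧ relIndef P ⊓ relKer Q = ⊥

end

noncomputable section

variable {V W : Type*} [AddCommGroup V] [Module ℂ V] [AddCommGroup W] [Module ℂ W]

/-- A canonical basis pair for a linear relation `S : V ⇉ W`: a basis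
`f₁,…,f_α, g₁,…,g_β, h₁,…,h_γ` of `V` and a basis `F₁,…,F_μ, G₁,…,G_β, H₁,…,H_ν` of `W`
such that `S` is spanned by the vectors `(0,Fᵢ)`, `(gⱼ,Gⱼ)`, `(hₗ,0)`. -/
structure CanonicalBasisPair (S : Submodule ℂ (V × W)) where
  α : ℕ
  β : ℕ
  γ : ℕ
  μ : ℕ
  ν : ℕ
  bV : Basis (Fin α ⊕ Fin β ⊕ Fin γ) ℂ V
  bW : Basis (Fin μ ⊕ Fin β ⊕ Fin ν) ℂ W
  hspan : S = Submodule.span ℂ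
      (Set.range (fun i : Fin μ => ((0 : V), bW (Sum.inl i))) ∪
       Set.range (fun j : Fin β => (bV (Sum.inr (Sum.inl j)), bW (Sum.inr (Sum.inl j)))) ∪
       Set.range (fun l : Fin γ => (bV (Sum.inr (Sum.inr l)), (0 : W))))

end

noncomputable section

variable {V W : Type*} [AddCommGroup V] [Module ℂ V] [AddCommGroup W] [Module ℂ W]

/-- The tuple `f₁, …, f_α, g_{i₁}, …, g_{i_s}` (with `i₁ < … < i_s` the elements of `s`)
in `V`, associated with a canonical basis pair. -/
def goodTupleV {S : Submodule ℂ (V × W)} (c : CanonicalBasisPair S)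
    (s : Finset (Fin c.β)) : Fin (c.α + s.card) → V :=
  Fin.addCases (fun i => c.bV (Sum.inl i))
    (fun j => c.bV (Sum.inr (Sum.inl ((s.orderIsoOfFin rfl j : s) : Fin c.β))))

/-- The tuple `F₁, …, F_μ, G_{i₁}, …, G_{i_s}` (with `i₁ < … < i_s` the elements of `s`)
in `W`, associated with a canonical basis pair. -/
def goodTupleW {S : Submodule ℂ (V × W)} (c : CanonicalBasisPair S)
    (s : Finset (Fin c.β)) : Fin (c.μ + s.card) → W :=
  Fin.addCases (fun i => c.bW (Sum.inl i))
    (fun j => c.bW (Sum.inr (Sum.inl ((s.orderIsoOfFin rfl j : s) : Fin c.β))))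

/-- `L : Λ(V) → Λ(W)` is the operator `λ(S)` obtained from the canonical basis pair `c` for `S`:
it sends each basis monomial `f₁∧…∧f_α∧g_{i₁}∧…∧g_{i_s}` to `F₁∧…∧F_μ∧G_{i₁}∧…∧G_{i_s}` and
every other monomial in the chosen basis of `V` (i.e. every monomial of basis vectors that
misses some `f` or contains some `h`) to `0`. -/
def IsLambda {S : Submodule ℂ (V × W)} (c : CanonicalBasisPair S)
    (L : ExteriorAlgebra ℂ V →ₗ[ℂ] ExteriorAlgebra ℂ W) : Prop :=
  (∀ s : Finset (Fin c.β),
      L (ExteriorAlgebra.ιMulti ℂ _ (goodTupleV c s)) =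
        ExteriorAlgebra.ιMulti ℂ _ (goodTupleW c s)) ∧
  (∀ (k : ℕ) (x : Fin k → (Fin c.α ⊕ Fin c.β ⊕ Fin c.γ)),
      ((∃ i : Fin c.α, Sum.inl i ∉ Set.range x) ∨
        (∃ l : Fin c.γ, Sum.inr (Sum.inr l) ∈ Set.range x)) →
      L (ExteriorAlgebra.ιMulti ℂ k (fun i => c.bV (x i))) = 0)

end

noncomputable section

variable {V W : Type*} [AddCommGroup V] [Module ℂ V] [AddCommGroup W] [Module ℂ W]

/-- The wedge product `x₁ ∧ … ∧ x_m` as an element of the `m`-th exterior power. -/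
def ιMultiP (m : ℕ) (x : Fin m → V) : ⋀[ℂ]^m V :=
  ⟨ExteriorAlgebra.ιMulti ℂ m x, ExteriorAlgebra.ιMulti_range ℂ m (Set.mem_range_self x)⟩

/-- `L : Λ^m V → Λ^m W` is the degree-`m` component `λ^m(S)` of the operator obtained from the
canonical basis pair `c` for `S`: it sends each degree-`m` basis monomial
`f₁∧…∧f_α∧g_{i₁}∧…∧g_{i_s}` to `F₁∧…∧F_μ∧G_{i₁}∧…∧G_{i_s}` and every other degree-`m`
monomial in the chosen basis of `V` to `0`. -/
def IsLambdaM {S : Submodule ℂ (V × W)} (c : CanonicalBasisPair S) (m : ℕ)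
    (L : (⋀[ℂ]^m V) →ₗ[ℂ] (⋀[ℂ]^m W)) : Prop :=
  (∀ (s : Finset (Fin c.β)) (h1 : c.α + s.card = m) (h2 : c.μ + s.card = m),
      L (ιMultiP m (goodTupleV c s ∘ Fin.cast h1.symm)) =
        ιMultiP m (goodTupleW c s ∘ Fin.cast h2.symm)) ∧
  (∀ x : Fin m → (Fin c.α ⊕ Fin c.β ⊕ Fin c.γ),
      ((∃ i : Fin c.α, Sum.inl i ∉ Set.range x) ∨
        (∃ l : Fin c.γ, Sum.inr (Sum.inr l) ∈ Set.range x)) →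
      L (ιMultiP m fun i => c.bV (x i)) = 0)

end

section Alternating

variable {κ K V M : Type*} [Field K] [AddCommGroup V] [Module K V] [AddCommGroup M] [Module K M]
  {m : ℕ}

/-- An alternating map in `m` arguments which kills every tuple of basis vectors not taken from
`b ∘ j` is a determinant in the coordinates selected by `j`. -/
lemma AlternatingMap.eq_det_coord_smul (b : Basis κ K V) {j : Fin m → κ}
    (hj : Function.Injective j) (f : V [⋀^Fin m]→ₗ[K] M)
    (hf : ∀ x : Fin m → κ, (∃ i, x i ∉ Set.range j) → f (b ∘ x) = 0) (v : Fin m → V) :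
    f v = (Matrix.of fun i k => b.repr (v i) (j k)).det • f (b ∘ j) := by
  classical
  let p : V →ₗ[K] (Fin m → K) := LinearMap.pi fun k => b.coord (j k)
  let d : V [⋀^Fin m]→ₗ[K] K := Matrix.detRowAlternating.compLinearMap p
  have hd : ∀ u, d u = (Matrix.of fun i k => b.repr (u i) (j k)).det := fun _ => rfl
  have hself : d (b ∘ j) = 1 := by
    rw [hd, ← Matrix.det_one (n := Fin m) (R := K)]
    congr 1
    ext i k
    simp [Finsupp.single_apply, Matrix.one_apply, hj.eq_iff]
  suffices h : f = (LinearMap.toSpanSingleton K M (f (b ∘ j))).compAlternatingMap d by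
    conv_lhs => rw [h]
    simp [hd]
  refine Basis.ext_alternating b fun x hx => ?_
  change f (b ∘ x) = d (b ∘ x) • f (b ∘ j)
  by_cases hr : ∃ i, x i ∉ Set.range j
  · rw [hf x hr]
    obtain ⟨i, hi⟩ := hr
    rw [hd, Matrix.det_eq_zero_of_row_eq_zero i, zero_smul]
    intro k
    have : x i ≠ j k := fun h => hi ⟨k, h.symm⟩
    simp [Finsupp.single_apply, this]
  · push Not at hr
    choose σ hσ using hr
    have hσi : Function.Injective σ := fun a c h => hx (by rw [← hσ a, ← hσ c, h])
    let e : Equiv.Perm (Fin m) := Equiv.ofBijective σ (Finite.injective_iff_bijective.mp hσi)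
    have hxe : b ∘ x = (b ∘ j) ∘ e := by
      ext i
      simp [e, hσ]
    rw [hxe, AlternatingMap.map_perm, AlternatingMap.map_perm, hself, smul_assoc, one_smul]

lemma AlternatingMap.exists_smul_of_mem_span (f : V [⋀^Fin m]→ₗ[K] M) {w w' : Fin m → V}
    (hw : LinearIndependent K w) (h : ∀ i, w' i ∈ Submodule.span K (Set.range w)) :
    ∃ c : K, f w' = c • f w := by
  let g := f.compLinearMap (Submodule.span K (Set.range w)).subtype
  have hg := g.eq_det_coord_smul (Basis.span hw) Function.injective_id
    (fun x ⟨i, hi⟩ => absurd ⟨x i, rfl⟩ hi) (fun i => ⟨w' i, h i⟩)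
  have hgw : g (Basis.span hw ∘ id) = f w :=
    congrArg f (funext fun i => congrArg Subtype.val (Basis.span_apply hw i))
  rw [hgw] at hg
  exact ⟨_, hg⟩

lemma exteriorPower.ιMulti_ne_zero {w : Fin m → V} (hw : LinearIndependent K w) :
    exteriorPower.ιMulti K m w ≠ 0 := by
  obtain ⟨p, hp⟩ := (Fintype.linearCombination K w).exists_leftInverse_of_injective
    (LinearMap.ker_eq_bot.mpr hw.fintypeLinearCombination_injective)
  have hpw : ∀ i, p (w i) = Pi.single i 1 := fun i => by
    simpa using LinearMap.congr_fun hp (Pi.single i 1)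
  intro h
  have h1 := exteriorPower.alternatingMapLinearEquiv_apply_ιMulti
    ((Matrix.detRowAlternating (n := Fin m) (R := K)).compLinearMap p) w
  rw [h, map_zero] at h1
  have h2 : (Matrix.of fun i => p (w i)) = 1 := by
    ext i k
    simp [hpw, Pi.single_apply, Matrix.one_apply, eq_comm]
  have h3 : (Matrix.of fun i => p (w i)).det = 0 := h1.symm
  rw [h2, Matrix.det_one] at h3
  exact one_ne_zero h3

/-- The linear map `L` on the exterior power sends the monomial in the basis vectors `b ∘ j` to the
wedge product of the linearly independent tuple `w`, and every other basis monomial to `0`. -/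
structure IsSingleMonomialMap (b : Basis κ K V) (j : Fin m → κ) (w : Fin m → V)
    (L : ⋀[K]^m V →ₗ[K] ⋀[K]^m V) : Prop where
  injective : Function.Injective j
  linearIndependent : LinearIndependent K w
  apply_monomial : L (exteriorPower.ιMulti K m (b ∘ j)) = exteriorPower.ιMulti K m w
  apply_eq_zero : ∀ x : Fin m → κ, (∃ i, x i ∉ Set.range j) →
    L (exteriorPower.ιMulti K m (b ∘ x)) = 0

namespace IsSingleMonomialMap

variable {b : Basis κ K V} {j : Fin m → κ} {w : Fin m → V} {L : ⋀[K]^m V →ₗ[K] ⋀[K]^m V}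

lemma apply_ιMulti (h : IsSingleMonomialMap b j w L) (v : Fin m → V) :
    L (exteriorPower.ιMulti K m v) =
      (Matrix.of fun i k => b.repr (v i) (j k)).det • exteriorPower.ιMulti K m w := by
  rw [← h.apply_monomial]
  exact (L.compAlternatingMap (exteriorPower.ιMulti K m)).eq_det_coord_smul b h.injective
    h.apply_eq_zero v

lemma finrank_range (h : IsSingleMonomialMap b j w L) : finrank K (LinearMap.range L) = 1 := by
  have hr : LinearMap.range L = Submodule.span K {exteriorPower.ιMulti K m w} := by
    apply le_antisymm
    · rw [LinearMap.range_eq_map, ← exteriorPower.ιMulti_span, Submodule.map_span,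
        Submodule.span_le]
      rintro _ ⟨_, ⟨v, rfl⟩, rfl⟩
      rw [h.apply_ιMulti]
      exact Submodule.smul_mem _ _ (Submodule.mem_span_singleton_self _)
    · rw [Submodule.span_singleton_le_iff_mem]
      exact ⟨_, h.apply_monomial⟩
  rw [hr, finrank_span_singleton (exteriorPower.ιMulti_ne_zero h.linearIndependent)]

lemma exists_eq_smul {κ' : Type*} {b' : Basis κ' K V} {j' : Fin m → κ'} {w' : Fin m → V}
    {L' : ⋀[K]^m V →ₗ[K] ⋀[K]^m V} (h : IsSingleMonomialMap b j w L)
    (h' : IsSingleMonomialMap b' j' w' L')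
    (hker : ∀ i ∉ Set.range j, ∀ k, b'.repr (b i) (j' k) = 0)
    (hspan : ∀ i, w' i ∈ Submodule.span K (Set.range w)) :
    ∃ c : K, c ≠ 0 ∧ L' = c • L := by
  obtain ⟨c, hc⟩ := (exteriorPower.ιMulti K m).exists_smul_of_mem_span h.linearIndependent hspan
  have h0 : ∀ x : Fin m → κ, (∃ i, x i ∉ Set.range j) →
      L' (exteriorPower.ιMulti K m (b ∘ x)) = 0 := by
    rintro x ⟨i, hi⟩
    rw [h'.apply_ιMulti, Matrix.det_eq_zero_of_row_eq_zero i, zero_smul]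
    exact fun k => hker _ hi k
  have hL : L' = ((Matrix.of fun i k => b'.repr (b (j i)) (j' k)).det * c) • L := by
    refine exteriorPower.linearMap_ext ?_
    ext1 v
    change L' (exteriorPower.ιMulti K m v) =
      ((Matrix.of fun i k => b'.repr (b (j i)) (j' k)).det * c) • L (exteriorPower.ιMulti K m v)
    have := (L'.compAlternatingMap (exteriorPower.ιMulti K m)).eq_det_coord_smul b h.injective h0 v
    refine this.trans ?_
    rw [LinearMap.compAlternatingMap_apply]
    rw [h.apply_ιMulti v, h'.apply_ιMulti, hc, smul_smul, smul_smul, smul_smul]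
    congr 1
    simp only [Function.comp_apply]
    ring
  refine ⟨_, fun hz => exteriorPower.ιMulti_ne_zero h'.linearIndependent ?_, hL⟩
  rw [← h'.apply_monomial, hL, hz, zero_smul, LinearMap.zero_apply]

end IsSingleMonomialMap

end Alternating

namespace CanonicalBasisPair

variable {V W : Type*} [AddCommGroup V] [Module ℂ V] [AddCommGroup W] [Module ℂ W]
  {S : Submodule ℂ (V × W)} (c : CanonicalBasisPair S)

lemma inr_F_mem (i : Fin c.μ) : ((0 : V), c.bW (Sum.inl i)) ∈ S :=
  c.hspan.ge (Submodule.subset_span (Or.inl (Or.inl ⟨i, rfl⟩)))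

lemma g_G_mem (i : Fin c.β) : (c.bV (Sum.inr (Sum.inl i)), c.bW (Sum.inr (Sum.inl i))) ∈ S :=
  c.hspan.ge (Submodule.subset_span (Or.inl (Or.inr ⟨i, rfl⟩)))

lemma inl_h_mem (i : Fin c.γ) : (c.bV (Sum.inr (Sum.inr i)), (0 : W)) ∈ S :=
  c.hspan.ge (Submodule.subset_span (Or.inr ⟨i, rfl⟩))

lemma repr_of_mem {p : V × W} (hp : p ∈ S) :
    (∀ i, c.bV.repr p.1 (Sum.inl i) = 0) ∧ (∀ i, c.bW.repr p.2 (Sum.inr (Sum.inr i)) = 0) ∧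
      ∀ i, c.bV.repr p.1 (Sum.inr (Sum.inl i)) = c.bW.repr p.2 (Sum.inr (Sum.inl i)) := by
  rw [c.hspan] at hp
  induction hp using Submodule.span_induction with
  | mem x hx =>
    rcases hx with (⟨i, rfl⟩ | ⟨i, rfl⟩) | ⟨i, rfl⟩ <;> simp [Finsupp.single_apply]
  | zero => simp
  | add x y _ _ hx hy => simp [hx.1, hx.2.1, hx.2.2, hy.1, hy.2.1, hy.2.2]
  | smul a x _ hx => simp [hx.1, hx.2.1, hx.2.2]

/-- The vectors spanning `S`, as a single family. -/
noncomputable def generators : Fin c.μ ⊕ Fin c.β ⊕ Fin c.γ → V × W :=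
  Sum.elim (fun i => (0, c.bW (Sum.inl i)))
    (Sum.elim (fun i => (c.bV (Sum.inr (Sum.inl i)), c.bW (Sum.inr (Sum.inl i))))
      (fun i => (c.bV (Sum.inr (Sum.inr i)), 0)))

lemma span_generators : Submodule.span ℂ (Set.range c.generators) = S := by
  refine Eq.trans ?_ c.hspan.symm
  rw [generators, Set.Sum.elim_range, Set.Sum.elim_range, Set.union_assoc]

lemma linearIndependent_generators : LinearIndependent ℂ c.generators := by
  rw [Fintype.linearIndependent_iff]
  intro a ha
  have h1 := congrArg (fun p : V × W => c.bV.repr p.1) ha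
  have h2 := congrArg (fun p : V × W => c.bW.repr p.2) ha
  rintro (i | i | i)
  · have := DFunLike.congr_fun h2 (Sum.inl i)
    simpa [generators, Fintype.sum_sum_type, Prod.fst_sum, Prod.snd_sum, Finsupp.single_apply]
      using this
  · have := DFunLike.congr_fun h1 (Sum.inr (Sum.inl i))
    simpa [generators, Fintype.sum_sum_type, Prod.fst_sum, Prod.snd_sum, Finsupp.single_apply]
      using this
  · have := DFunLike.congr_fun h1 (Sum.inr (Sum.inr i))
    simpa [generators, Fintype.sum_sum_type, Prod.fst_sum, Prod.snd_sum, Finsupp.single_apply]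
      using this

lemma finrank_eq : finrank ℂ S = c.μ + (c.β + c.γ) := by
  have h := finrank_span_eq_card c.linearIndependent_generators
  rw [c.span_generators] at h
  simpa using h

lemma μ_eq_α (h : finrank ℂ S = finrank ℂ V) : c.μ = c.α := by
  have hV := finrank_eq_card_basis c.bV
  rw [← h, c.finrank_eq] at hV
  simp at hV
  omega

/-- The positions in the basis of `V` of the entries of `goodTupleV c s`. -/
def indexV (s : Finset (Fin c.β)) : Fin (c.α + s.card) → Fin c.α ⊕ Fin c.β ⊕ Fin c.γ :=
  Fin.addCases Sum.inl fun j => Sum.inr (Sum.inl ((s.orderIsoOfFin rfl j : s) : Fin c.β))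

/-- The positions in the basis of `W` of the entries of `goodTupleW c s`. -/
def indexW (s : Finset (Fin c.β)) : Fin (c.μ + s.card) → Fin c.μ ⊕ Fin c.β ⊕ Fin c.ν :=
  Fin.addCases Sum.inl fun j => Sum.inr (Sum.inl ((s.orderIsoOfFin rfl j : s) : Fin c.β))

lemma goodTupleV_eq (s : Finset (Fin c.β)) : goodTupleV c s = c.bV ∘ c.indexV s := by
  ext i
  refine Fin.addCases (fun i => ?_) (fun i => ?_) i <;> simp [goodTupleV, indexV]

lemma goodTupleW_eq (s : Finset (Fin c.β)) : goodTupleW c s = c.bW ∘ c.indexW s := by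
  ext i
  refine Fin.addCases (fun i => ?_) (fun i => ?_) i <;> simp [goodTupleW, indexW]

lemma indexV_injective (s : Finset (Fin c.β)) : Function.Injective (c.indexV s) := by
  intro x y
  refine Fin.addCases (fun x => ?_) (fun x => ?_) x <;>
    refine Fin.addCases (fun y => ?_) (fun y => ?_) y <;>
    simp [indexV]

lemma indexW_injective (s : Finset (Fin c.β)) : Function.Injective (c.indexW s) := by
  intro x y
  refine Fin.addCases (fun x => ?_) (fun x => ?_) x <;>
    refine Fin.addCases (fun y => ?_) (fun y => ?_) y <;>
    simp [indexW]

lemma range_indexV (s : Finset (Fin c.β)) :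
    Set.range (c.indexV s) = Set.range Sum.inl ∪ (Sum.inr ∘ Sum.inl) '' (s : Set (Fin c.β)) := by
  ext x
  constructor
  · rintro ⟨i, rfl⟩
    refine Fin.addCases (fun i => ?_) (fun i => ?_) i
    · simp [indexV]
    · right
      exact ⟨(s.orderIsoOfFin rfl i : s), (s.orderIsoOfFin rfl i).2, by simp [indexV]⟩
  · rintro (⟨i, rfl⟩ | ⟨i, hi, rfl⟩)
    · exact ⟨Fin.castAdd _ i, by simp [indexV]⟩
    · exact ⟨Fin.natAdd _ ((s.orderIsoOfFin rfl).symm ⟨i, hi⟩), by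
        rw [indexV, Fin.addCases_right, OrderIso.apply_symm_apply]
        rfl⟩

lemma range_indexW (s : Finset (Fin c.β)) :
    Set.range (c.indexW s) = Set.range Sum.inl ∪ (Sum.inr ∘ Sum.inl) '' (s : Set (Fin c.β)) := by
  ext x
  constructor
  · rintro ⟨i, rfl⟩
    refine Fin.addCases (fun i => ?_) (fun i => ?_) i
    · simp [indexW]
    · right
      exact ⟨(s.orderIsoOfFin rfl i : s), (s.orderIsoOfFin rfl i).2, by simp [indexW]⟩
  · rintro (⟨i, rfl⟩ | ⟨i, hi, rfl⟩)
    · exact ⟨Fin.castAdd _ i, by simp [indexW]⟩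
    · exact ⟨Fin.natAdd _ ((s.orderIsoOfFin rfl).symm ⟨i, hi⟩), by
        rw [indexW, Fin.addCases_right, OrderIso.apply_symm_apply]
        rfl⟩

lemma linearIndependent_goodTupleW (s : Finset (Fin c.β)) :
    LinearIndependent ℂ (goodTupleW c s) := by
  rw [c.goodTupleW_eq]
  exact c.bW.linearIndependent.comp _ (c.indexW_injective s)

lemma span_goodTupleW (s : Finset (Fin c.β)) :
    Submodule.span ℂ (Set.range (goodTupleW c s)) =
      Submodule.span ℂ
        (c.bW '' (Set.range Sum.inl ∪ (Sum.inr ∘ Sum.inl) '' (s : Set (Fin c.β)))) := by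
  rw [c.goodTupleW_eq, Set.range_comp, c.range_indexW]

lemma span_goodTupleW_empty : Submodule.span ℂ (Set.range (goodTupleW c ∅)) = relIndef S := by
  rw [c.span_goodTupleW]
  apply le_antisymm
  · rw [Submodule.span_le]
    rintro _ ⟨_, (⟨i, rfl⟩ | ⟨i, hi, rfl⟩), rfl⟩
    · exact c.inr_F_mem i
    · simp at hi
  · intro w hw
    have h := c.repr_of_mem (show ((0 : V), w) ∈ S from hw)
    rw [c.bW.mem_span_image]
    rintro (i | i | i) hi
    · simp
    · exact absurd (h.2.2 i).symm (by simpa using hi)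
    · exact absurd (h.2.1 i) (by simpa using hi)

lemma span_goodTupleW_univ :
    Submodule.span ℂ (Set.range (goodTupleW c Finset.univ)) = relIm S := by
  rw [c.span_goodTupleW]
  apply le_antisymm
  · rw [Submodule.span_le]
    rintro _ ⟨_, (⟨i, rfl⟩ | ⟨i, hi, rfl⟩), rfl⟩
    · exact ⟨_, c.inr_F_mem i, rfl⟩
    · exact ⟨_, c.g_G_mem i, rfl⟩
  · rintro _ ⟨p, hp, rfl⟩
    have h := c.repr_of_mem hp
    rw [c.bW.mem_span_image]
    rintro (i | i | i) hi
    · simp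
    · simp
    · exact absurd (h.2.1 i) (by simpa using hi)

lemma finrank_span_goodTupleW (s : Finset (Fin c.β)) :
    finrank ℂ (Submodule.span ℂ (Set.range (goodTupleW c s))) = c.μ + s.card := by
  simpa using finrank_span_eq_card (c.linearIndependent_goodTupleW s)

lemma basis_mem_relDom {i : Fin c.α ⊕ Fin c.β ⊕ Fin c.γ} (hi : i ∉ Set.range (c.indexV ∅)) :
    c.bV i ∈ relDom S := by
  rw [c.range_indexV] at hi
  rcases i with i | i | i
  · simp at hi
  · exact ⟨_, c.g_G_mem i, rfl⟩
  · exact ⟨_, c.inl_h_mem i, rfl⟩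

lemma basis_mem_relKer {i : Fin c.α ⊕ Fin c.β ⊕ Fin c.γ}
    (hi : i ∉ Set.range (c.indexV Finset.univ)) : c.bV i ∈ relKer S := by
  rw [c.range_indexV] at hi
  rcases i with i | i | i
  · simp at hi
  · simp at hi
  · exact c.inl_h_mem i

lemma repr_eq_zero_of_mem_relDom {v : V} (hv : v ∈ relDom S) (k) :
    c.bV.repr v (c.indexV ∅ k) = 0 := by
  obtain ⟨p, hp, rfl⟩ := hv
  have hk : c.indexV ∅ k ∈ Set.range (c.indexV ∅) := ⟨k, rfl⟩
  rw [c.range_indexV] at hk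
  obtain ⟨i, hi⟩ | ⟨i, hi, -⟩ := hk
  · rw [← hi]
    exact (c.repr_of_mem hp).1 i
  · simp at hi

lemma repr_eq_zero_of_mem_relKer {v : V} (hv : v ∈ relKer S) (k) :
    c.bV.repr v (c.indexV Finset.univ k) = 0 := by
  have h := c.repr_of_mem (show (v, (0 : W)) ∈ S from hv)
  have hk : c.indexV Finset.univ k ∈ Set.range (c.indexV Finset.univ) := ⟨k, rfl⟩
  rw [c.range_indexV] at hk
  obtain ⟨i, hi⟩ | ⟨i, -, hi⟩ := hk
  · rw [← hi]
    exact h.1 i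
  · rw [← hi]
    simpa using h.2.2 i

end CanonicalBasisPair

section Extreme

variable {V : Type*} [AddCommGroup V] [Module ℂ V] {S : Submodule ℂ (V × V)}
  {c : CanonicalBasisPair S} {m : ℕ} {L : ⋀[ℂ]^m V →ₗ[ℂ] ⋀[ℂ]^m V}

lemma IsLambdaM.isSingleMonomialMap (hL : IsLambdaM c m L) (s : Finset (Fin c.β))
    (h1 : m = c.α + s.card) (h2 : m = c.μ + s.card)
    (hs : ∀ x : Fin m → Fin c.α ⊕ Fin c.β ⊕ Fin c.γ, (∃ i, x i ∉ Set.range (c.indexV s)) →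
      (∃ i, Sum.inl i ∉ Set.range x) ∨ ∃ l, Sum.inr (Sum.inr l) ∈ Set.range x) :
    IsSingleMonomialMap c.bV (c.indexV s ∘ Fin.cast h1) (goodTupleW c s ∘ Fin.cast h2) L where
  injective := (c.indexV_injective s).comp (Fin.cast_injective h1)
  linearIndependent := (c.linearIndependent_goodTupleW s).comp _ (Fin.cast_injective h2)
  apply_monomial := by
    have h := hL.1 s h1.symm h2.symm
    rw [c.goodTupleV_eq] at h
    exact h
  apply_eq_zero := by
    rintro x ⟨i, hi⟩
    refine hL.2 x (hs x ⟨i, fun ⟨k, hk⟩ => hi ⟨Fin.cast h1.symm k, ?_⟩⟩)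
    simpa using hk

lemma IsLambdaM.isSingleMonomialMap_empty (hL : IsLambdaM c m L)
    (h1 : m = c.α + (∅ : Finset (Fin c.β)).card) (h2 : m = c.μ + (∅ : Finset (Fin c.β)).card) :
    IsSingleMonomialMap c.bV (c.indexV ∅ ∘ Fin.cast h1) (goodTupleW c ∅ ∘ Fin.cast h2) L := by
  refine hL.isSingleMonomialMap ∅ h1 h2 fun x hx => Or.inl ?_
  by_contra! hall
  obtain ⟨i, hi⟩ := hx
  choose t ht using hall
  have ht_inj : Function.Injective t := fun a a' h => Sum.inl_injective (by rw [← ht, ← ht, h])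
  have ht_surj : Function.Surjective t :=
    ((Fintype.bijective_iff_injective_and_card t).mpr ⟨ht_inj, by simp at h1 ⊢; omega⟩).2
  obtain ⟨a, rfl⟩ := ht_surj i
  refine hi ?_
  rw [c.range_indexV, ht]
  exact Or.inl ⟨a, rfl⟩

lemma IsLambdaM.isSingleMonomialMap_univ (hL : IsLambdaM c m L)
    (h1 : m = c.α + (Finset.univ : Finset (Fin c.β)).card)
    (h2 : m = c.μ + (Finset.univ : Finset (Fin c.β)).card) :
    IsSingleMonomialMap c.bV (c.indexV Finset.univ ∘ Fin.cast h1)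
      (goodTupleW c Finset.univ ∘ Fin.cast h2) L := by
  refine hL.isSingleMonomialMap Finset.univ h1 h2 fun x ⟨i, hi⟩ => Or.inr ?_
  rw [c.range_indexV] at hi
  rcases h : x i with a | a | a
  · simp [h] at hi
  · simp [h] at hi
  · exact ⟨a, i, h⟩

end Extreme

/-- At the extreme degrees `m = dim Indef P` and `m = dim Im P`, the operator `λ^m(P)` has
rank 1 and depends (up to a nonzero scalar) only on `(Dom P, Indef P)`, resp. on
`(Ker P, Im P)`; in particular one may take `Q = Dom P ⊕ Indef P`, resp. `R = Ker P ⊕ Im P`. -/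
theorem lambdaM_extreme_degrees
    {V : Type*} [AddCommGroup V] [Module ℂ V] [FiniteDimensional ℂ V]
    {n : ℕ} (hn : finrank ℂ V = n)
    (P : Submodule ℂ (V × V)) (hP : finrank ℂ P = n) :
    ((∀ (m : ℕ), m = finrank ℂ (relIndef P) →
      ∀ (cP : CanonicalBasisPair P) (L : (⋀[ℂ]^m V) →ₗ[ℂ] (⋀[ℂ]^m V)), IsLambdaM cP m L →
        finrank ℂ (LinearMap.range L) = 1 ∧
        ∀ (Q : Submodule ℂ (V × V)), finrank ℂ Q = n →
          relIndef Q = relIndef P → relDom Q = relDom P →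
          ∀ (cQ : CanonicalBasisPair Q) (LQ : (⋀[ℂ]^m V) →ₗ[ℂ] (⋀[ℂ]^m V)),
            IsLambdaM cQ m LQ → ∃ c : ℂ, c ≠ 0 ∧ LQ = c • L)) ∧
    ((∀ (m : ℕ), m = finrank ℂ (relIm P) →
      ∀ (cP : CanonicalBasisPair P) (L : (⋀[ℂ]^m V) →ₗ[ℂ] (⋀[ℂ]^m V)), IsLambdaM cP m L →
        finrank ℂ (LinearMap.range L) = 1 ∧
        ∀ (R : Submodule ℂ (V × V)), finrank ℂ R = n →
          relIm R = relIm P → relKer R = relKer P →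
          ∀ (cR : CanonicalBasisPair R) (LR : (⋀[ℂ]^m V) →ₗ[ℂ] (⋀[ℂ]^m V)),
            IsLambdaM cR m LR → ∃ c : ℂ, c ≠ 0 ∧ LR = c • L)) := by
  subst hn
  refine ⟨fun m hm cP L hL => ?_, fun m hm cP L hL => ?_⟩
  · have dims : ∀ {S : Submodule ℂ (V × V)} (c : CanonicalBasisPair S),
        finrank ℂ S = finrank ℂ V → relIndef S = relIndef P →
        m = c.α + (∅ : Finset (Fin c.β)).card ∧ m = c.μ + (∅ : Finset (Fin c.β)).card := by
      intro S c hS hI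
      rw [hm, ← hI, ← c.span_goodTupleW_empty, c.finrank_span_goodTupleW, c.μ_eq_α hS]
      exact ⟨rfl, rfl⟩
    obtain ⟨h1, h2⟩ := dims cP hP rfl
    have h := hL.isSingleMonomialMap_empty h1 h2
    refine ⟨h.finrank_range, fun Q hQ hI hD cQ LQ hLQ => ?_⟩
    obtain ⟨h1', h2'⟩ := dims cQ hQ hI
    refine h.exists_eq_smul (hLQ.isSingleMonomialMap_empty h1' h2') (fun i hi k => ?_) fun i => ?_
    · refine cQ.repr_eq_zero_of_mem_relDom ?_ _
      rw [hD]
      refine cP.basis_mem_relDom fun ⟨a, ha⟩ => hi ⟨Fin.cast h1.symm a, ha⟩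
    · have hr := (finCongr h2).surjective.range_comp (goodTupleW cP ∅)
      rw [show ⇑(finCongr h2) = Fin.cast h2 from rfl] at hr
      rw [hr, cP.span_goodTupleW_empty, ← hI,
        ← cQ.span_goodTupleW_empty]
      exact Submodule.subset_span ⟨_, rfl⟩
  · have dims : ∀ {S : Submodule ℂ (V × V)} (c : CanonicalBasisPair S),
        finrank ℂ S = finrank ℂ V → relIm S = relIm P →
        m = c.α + (Finset.univ : Finset (Fin c.β)).card ∧
          m = c.μ + (Finset.univ : Finset (Fin c.β)).card := by
      intro S c hS hI
      rw [hm, ← hI, ← c.span_goodTupleW_univ, c.finrank_span_goodTupleW, c.μ_eq_α hS]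
      exact ⟨rfl, rfl⟩
    obtain ⟨h1, h2⟩ := dims cP hP rfl
    have h := hL.isSingleMonomialMap_univ h1 h2
    refine ⟨h.finrank_range, fun R hR hI hK cR LR hLR => ?_⟩
    obtain ⟨h1', h2'⟩ := dims cR hR hI
    refine h.exists_eq_smul (hLR.isSingleMonomialMap_univ h1' h2') (fun i hi k => ?_) fun i => ?_
    · refine cR.repr_eq_zero_of_mem_relKer ?_ _
      rw [hK]
      refine cP.basis_mem_relKer fun ⟨a, ha⟩ => hi ⟨Fin.cast h1.symm a, ha⟩
    · have hr := (finCongr h2).surjective.range_comp (goodTupleW cP Finset.univ)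
      rw [show ⇑(finCongr h2) = Fin.cast h2 from rfl] at hr
      rw [hr,
        cP.span_goodTupleW_univ, ← hI, ← cR.span_goodTupleW_univ]
      exact Submodule.subset_span ⟨_, rfl⟩
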